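/- There exists a universal constant c > 0 such that for all 0 < p < 1, the Bernoulli relative entropy satisfies I_p(p/2) ≥ c·p, where I_p(q) = q log(q/p) + (1−q) log((1−q)/(1−p)). Consequently I_p(q) ≥ c·p for all 0 < q ≤ p/2. -/

import Mathlib

/-- Bernoulli relative entropy `I_p(q) = q log(q/p) + (1−q) log((1−q)/(1−p))`. -/
noncomputable def bernoulliRelEntropy (p q : ℝ) : ℝ :=
  q * Real.log (q / p) + (1 - q) * Real.log ((1 - q) / (1 - p))

/-- There is a universal constant `c > 0` such that for all `0 < p < 1`,
`I_p(p/2) ≥ c p`, and consequently `I_p(q) ≥ c p` for all `0 < q ≤ p/2`. -/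
theorem relEntropy_half_lower_bound :
    ∃ c : ℝ, 0 < c ∧ ∀ p : ℝ, 0 < p → p < 1 →
      c * p ≤ bernoulliRelEntropy p (p / 2) ∧
      ∀ q : ℝ, 0 < q → q ≤ p / 2 → c * p ≤ bernoulliRelEntropy p q := by
  have hl : Real.log 2 < 1 := by linarith [Real.log_two_lt_d9]
  have hl0 : 0 < Real.log 2 := Real.log_pos (by norm_num)
  have key : ∀ p : ℝ, 0 < p → p < 1 → ∀ q : ℝ, 0 < q → q ≤ p / 2 →
      (1 - Real.log 2) / 2 * p ≤ bernoulliRelEntropy p q := by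
    intro p hp hp1 q hq hqp
    unfold bernoulliRelEntropy
    have h1q : 0 < 1 - q := by linarith
    have h1p : 0 < 1 - p := by linarith
    have hA : q * (1 - (q / (p / 2))⁻¹) ≤ q * Real.log (q / (p / 2)) :=
      mul_le_mul_of_nonneg_left (Real.one_sub_inv_le_log_of_pos (by positivity)) hq.le
    have hB : (1 - q) * (1 - ((1 - q) / (1 - p))⁻¹) ≤ (1 - q) * Real.log ((1 - q) / (1 - p)) :=
      mul_le_mul_of_nonneg_left (Real.one_sub_inv_le_log_of_pos (by positivity)) h1q.le
    have eA : q * (1 - (q / (p / 2))⁻¹) = q - p / 2 := by field_simp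
    have eB : (1 - q) * (1 - ((1 - q) / (1 - p))⁻¹) = p - q := by
      rw [inv_div, mul_sub, mul_div_cancel₀ _ h1q.ne']; ring
    have eL : Real.log (q / (p / 2)) = Real.log (q / p) + Real.log 2 := by
      rw [← Real.log_mul (by positivity) (by norm_num)]
      congr 1
      field_simp
    rw [eA, eL] at hA
    rw [eB] at hB
    nlinarith
  refine ⟨(1 - Real.log 2) / 2, by linarith, fun p hp hp1 => ⟨?_, key p hp hp1⟩⟩
  exact key p hp hp1 _ (by linarith) le_rfl
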